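/- Let G be the Klein four-group and let S = (S^2)^{*3} ≅ S^8 with the diagonal G-action coming from the octahedral G-action on S^2 by the three 180-degree rotations. Let [4] be a 4-point G-set on which G acts (via the isomorphism G ≅ the group of double transpositions in Σ_4) transitively. Then there is no G-equivariant continuous map from the join S * [4] to S. -/

import Mathlib

open scoped Classical

namespace JoinBU

/-- The Klein four-group `G = (ℤ/2)²`. -/
abbrev KleinG := ZMod 2 × ZMod 2

/-- The sign with which `g ∈ G` acts on the `i`-th coordinate of `ℝ³`: the three
nontrivial elements act by the diagonal sign matrices `diag(1,-1,-1)`,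
`diag(-1,1,-1)`, `diag(-1,-1,1)` (the `180°`-rotations of the octahedral sphere). -/
def χ : Fin 3 → KleinG → ℝ
  | 0, g => if g.2 = 0 then 1 else -1
  | 1, g => if g.1 = 0 then 1 else -1
  | 2, g => if g.1 + g.2 = 0 then 1 else -1

/-- `S = (S²)^{*3} ≅ S⁸`, modeled as the unit sphere in `ℝ³ ⊕ ℝ³ ⊕ ℝ³`. -/
def S : Set (Fin 3 → Fin 3 → ℝ) :=
  {x | ∑ b : Fin 3, ∑ i : Fin 3, (x b i) ^ 2 = 1}

/-- The diagonal `G`-action on `S`. -/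
def σ (g : KleinG) (x : Fin 3 → Fin 3 → ℝ) : Fin 3 → Fin 3 → ℝ :=
  fun b i => χ i g * x b i

/-- The join `S * [4]` of `S` with a free transitive `4`-point `G`-set (the points of
`[4]` indexed by the elements of `G` itself): a point is a formal combination
`(1-t)·x ⊕ t·e_g` with `x ∈ S`, `t ∈ [0,1]`, modeled as the set of pairs `(z, y)`
where `y ≥ 0` is supported on at most one point of `[4]` and `‖z‖ + ∑ y = 1`. -/
def J : Set ((Fin 3 → Fin 3 → ℝ) × (KleinG → ℝ)) :=
  {p | (∀ g, 0 ≤ p.2 g) ∧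
       (∃ g₀, ∀ g, g ≠ g₀ → p.2 g = 0) ∧
       Real.sqrt (∑ b : Fin 3, ∑ i : Fin 3, (p.1 b i) ^ 2) + ∑ g : KleinG, p.2 g = 1}

/-- The diagonal `G`-action on the join `S * [4]`: blockwise sign action on the `S`
part and the (free, transitive) translation action on the `4`-point set. -/
def τ (k : KleinG) (p : (Fin 3 → Fin 3 → ℝ) × (KleinG → ℝ)) :
    (Fin 3 → Fin 3 → ℝ) × (KleinG → ℝ) :=
  (σ k p.1, fun g => p.2 (g + k))

/-! ### Mod 2 simplicial chains -/

/-- Mod 2 chains on the full simplex with vertex set `α` (augmented). -/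
abbrev Ch (α : Type) := Finset α →₀ ZMod 2

noncomputable def bd {α : Type} [DecidableEq α] : Ch α →ₗ[ZMod 2] Ch α :=
  Finsupp.linearCombination (ZMod 2) (fun s => ∑ a ∈ s, Finsupp.single (s.erase a) (1 : ZMod 2))

noncomputable def cone {α : Type} [DecidableEq α] (a : α) : Ch α →ₗ[ZMod 2] Ch α :=
  Finsupp.linearCombination (ZMod 2)
    (fun s => if a ∈ s then 0 else Finsupp.single (insert a s) (1 : ZMod 2))

noncomputable def push {α β : Type} [DecidableEq β] (f : α → β) : Ch α →ₗ[ZMod 2] Ch β :=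
  Finsupp.linearCombination (ZMod 2)
    (fun s => if Set.InjOn f (s : Set α) then Finsupp.single (s.image f) (1 : ZMod 2) else 0)

noncomputable abbrev sg {α : Type} (s : Finset α) : Ch α := Finsupp.single s (1 : ZMod 2)

set_option linter.unusedSectionVars false

section chains
variable {α β γ : Type} [DecidableEq α] [DecidableEq β] [DecidableEq γ]

theorem bd_sg (s : Finset α) : bd (sg s) = ∑ a ∈ s, sg (s.erase a) := by
  simp [bd, sg]

theorem cone_sg_mem {a : α} {s : Finset α} (h : a ∈ s) : cone a (sg s) = 0 := by
  simp [cone, sg, h]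

theorem cone_sg_notMem {a : α} {s : Finset α} (h : a ∉ s) :
    cone a (sg s) = sg (insert a s) := by
  simp [cone, sg, h]

theorem push_sg_inj {f : α → β} {s : Finset α} (h : Set.InjOn f (s : Set α)) :
    push f (sg s) = sg (s.image f) := by
  simp [push, sg, h]

theorem push_sg_ninj {f : α → β} {s : Finset α} (h : ¬ Set.InjOn f (s : Set α)) :
    push f (sg s) = 0 := by
  simp [push, sg, h]

theorem lin_ext {M : Type} [AddCommGroup M] [Module (ZMod 2) M] {f g : Ch α →ₗ[ZMod 2] M}
    (h : ∀ s, f (sg s) = g (sg s)) : f = g := by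
  apply Finsupp.lhom_ext'
  intro s
  ext
  exact h s

theorem ch_add_self (c : Ch α) : c + c = 0 := by
  ext s
  simp only [Finsupp.add_apply, Finsupp.zero_apply]
  exact CharTwo.add_self_eq_zero _

theorem bd_cone (a : α) (c : Ch α) : bd (cone a c) = c + cone a (bd c) := by
  have : (bd ∘ₗ cone a : Ch α →ₗ[ZMod 2] Ch α) = LinearMap.id + cone a ∘ₗ bd := by
    apply lin_ext
    intro s
    simp only [LinearMap.comp_apply, LinearMap.add_apply, LinearMap.id_apply]
    by_cases h : a ∈ s
    · rw [cone_sg_mem h, map_zero, bd_sg, map_sum, Finset.sum_eq_single a]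
      · rw [cone_sg_notMem (Finset.notMem_erase a s), Finset.insert_erase h, ch_add_self]
      · intro b hb hba
        exact cone_sg_mem (Finset.mem_erase.2 ⟨hba.symm, h⟩)
      · intro h'; exact absurd h h'
    · rw [cone_sg_notMem h, bd_sg, Finset.sum_insert h, Finset.erase_insert h, bd_sg, map_sum]
      congr 1
      apply Finset.sum_congr rfl
      intro x hx
      have hxa : a ≠ x := fun e => h (e ▸ hx)
      rw [cone_sg_notMem (fun h' => h (Finset.mem_of_mem_erase h')),
        Finset.erase_insert_of_ne hxa]
  exact LinearMap.congr_fun this c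

theorem bd_bd (c : Ch α) : bd (bd c) = 0 := by
  have : (bd ∘ₗ bd : Ch α →ₗ[ZMod 2] Ch α) = 0 := by
    apply lin_ext
    intro s
    induction s using Finset.induction_on with
    | empty => simp [bd_sg]
    | insert a s h ih =>
      simp only [LinearMap.comp_apply, LinearMap.zero_apply] at ih ⊢
      rw [← cone_sg_notMem h, bd_cone, map_add, bd_cone, ih, map_zero, add_zero, ch_add_self]
  exact LinearMap.congr_fun this c

theorem push_cone (f : α → β) (a : α) (c : Ch α) :
    push f (cone a c) = cone (f a) (push f c) := by
  have : (push f ∘ₗ cone a : Ch α →ₗ[ZMod 2] Ch β) = cone (f a) ∘ₗ push f := by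
    apply lin_ext
    intro s
    simp only [LinearMap.comp_apply]
    by_cases h : a ∈ s
    · rw [cone_sg_mem h, map_zero]
      by_cases hi : Set.InjOn f (s : Set α)
      · rw [push_sg_inj hi, cone_sg_mem (Finset.mem_image_of_mem f h)]
      · rw [push_sg_ninj hi, map_zero]
    · rw [cone_sg_notMem h]
      have key : Set.InjOn f ((insert a s : Finset α) : Set α) ↔
          Set.InjOn f (s : Set α) ∧ f a ∉ s.image f := by
        rw [Finset.coe_insert, Set.injOn_insert (by simpa using h)]
        simp
      by_cases hi : Set.InjOn f (s : Set α)
      · by_cases hm : f a ∈ s.image f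
        · rw [push_sg_inj hi, cone_sg_mem hm, push_sg_ninj (fun h' => (key.1 h').2 hm)]
        · rw [push_sg_inj hi, cone_sg_notMem hm, push_sg_inj (key.2 ⟨hi, hm⟩),
            Finset.image_insert]
      · rw [push_sg_ninj hi, map_zero, push_sg_ninj (fun h' => hi (key.1 h').1)]
  exact LinearMap.congr_fun this c

theorem push_bd (f : α → β) (c : Ch α) : push f (bd c) = bd (push f c) := by
  have : (push f ∘ₗ bd : Ch α →ₗ[ZMod 2] Ch β) = bd ∘ₗ push f := by
    apply lin_ext
    intro s
    simp only [LinearMap.comp_apply]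
    induction s using Finset.induction_on with
    | empty =>
      rw [push_sg_inj (by simp)]
      simp [bd_sg]
    | insert a s h ih =>
      rw [← cone_sg_notMem h, bd_cone, map_add, push_cone, push_cone, bd_cone, ih]
  exact LinearMap.congr_fun this c

theorem push_push (f : α → β) (g : β → γ) (c : Ch α) :
    push g (push f c) = push (g ∘ f) c := by
  have : (push g ∘ₗ push f : Ch α →ₗ[ZMod 2] Ch γ) = push (g ∘ f) := by
    apply lin_ext
    intro s
    simp only [LinearMap.comp_apply]
    induction s using Finset.induction_on with
    | empty =>
      rw [push_sg_inj (by simp), push_sg_inj (by simp), push_sg_inj (by simp)]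
      simp
    | insert a s h ih =>
      rw [← cone_sg_notMem h, push_cone, push_cone, push_cone, ih]
      rfl
  exact LinearMap.congr_fun this c

/-- Chains all of whose simplices satisfy `P`. -/
abbrev Sup (P : Finset α → Prop) : Submodule (ZMod 2) (Ch α) :=
  Finsupp.supported (ZMod 2) (ZMod 2) {s | P s}

theorem sg_mem_Sup {P : Finset α → Prop} {s : Finset α} (h : P s) : sg s ∈ Sup P :=
  Finsupp.single_mem_supported _ _ h

theorem map_mem_of_Sup {M : Type} [AddCommGroup M] [Module (ZMod 2) M]
    {P : Finset α → Prop} {Q : Submodule (ZMod 2) M}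
    (f : Ch α →ₗ[ZMod 2] M) (h : ∀ s, P s → f (sg s) ∈ Q) {c : Ch α} (hc : c ∈ Sup P) :
    f c ∈ Q := by
  have : Sup P ≤ Q.comap f := by
    rw [Sup, Finsupp.supported_eq_span_single, Submodule.span_le]
    rintro _ ⟨s, hs, rfl⟩
    exact h s hs
  exact this hc

theorem map_eq_of_Sup {M : Type} [AddCommGroup M] [Module (ZMod 2) M]
    {P : Finset α → Prop}
    (f g : Ch α →ₗ[ZMod 2] M) (h : ∀ s, P s → f (sg s) = g (sg s)) {c : Ch α} (hc : c ∈ Sup P) :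
    f c = g c := by
  have := map_mem_of_Sup (Q := (⊥ : Submodule (ZMod 2) M)) (f - g)
    (fun s hs => by simp [h s hs]) hc
  simpa [sub_eq_zero] using this

theorem push_congr {P : Finset α → Prop} {f g : α → β}
    (h : ∀ s, P s → ∀ x ∈ s, f x = g x) {c : Ch α} (hc : c ∈ Sup P) : push f c = push g c := by
  apply map_eq_of_Sup _ _ _ hc
  intro s hs
  have he : Set.EqOn f g (s : Set α) := fun x hx => h s hs x hx
  by_cases hi : Set.InjOn f (s : Set α)
  · rw [push_sg_inj hi, push_sg_inj (hi.congr he)]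
    congr 1
    exact Finset.image_congr he
  · rw [push_sg_ninj hi, push_sg_ninj (fun h' => hi (h'.congr he.symm))]

theorem push_apply_image {f : α → β} (hf : Function.Injective f) (c : Ch α) (s : Finset α) :
    push f c (s.image f) = c s := by
  have : (Finsupp.lapply (s.image f) ∘ₗ push f : Ch α →ₗ[ZMod 2] ZMod 2) = Finsupp.lapply s := by
    apply lin_ext
    intro t
    simp only [LinearMap.comp_apply, Finsupp.lapply_apply]
    rw [push_sg_inj hf.injOn]
    simp only [sg, Finsupp.single_apply, (Finset.image_injective hf).eq_iff]
  exact LinearMap.congr_fun this c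

/-! ### Subdivision -/

noncomputable def sdF (b : Finset α → α) (s : Finset α) : Ch α :=
  if s = ∅ then sg ∅ else cone (b s) (∑ a ∈ s.attach, sdF b (s.erase a.1))
termination_by s.card
decreasing_by exact Finset.card_erase_lt_of_mem a.2

noncomputable def sd (b : Finset α → α) : Ch α →ₗ[ZMod 2] Ch α :=
  Finsupp.linearCombination (ZMod 2) (sdF b)

theorem sd_sg' (b : Finset α → α) (s : Finset α) : sd b (sg s) = sdF b s := by
  simp [sd, sg]

theorem sd_empty (b : Finset α → α) : sd b (sg ∅) = sg ∅ := by
  rw [sd_sg', sdF]; simp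

theorem sd_sg (b : Finset α → α) {s : Finset α} (h : s ≠ ∅) :
    sd b (sg s) = cone (b s) (sd b (bd (sg s))) := by
  rw [sd_sg', sdF, if_neg h, bd_sg, map_sum (sd b)]
  refine congrArg (cone (b s)) ?_
  rw [← Finset.sum_attach s]
  exact Finset.sum_congr rfl fun a _ => (sd_sg' b _).symm

theorem sd_bd (b : Finset α → α) (c : Ch α) : bd (sd b c) = sd b (bd c) := by
  have : (bd ∘ₗ sd b : Ch α →ₗ[ZMod 2] Ch α) = sd b ∘ₗ bd := by
    apply lin_ext
    intro s
    simp only [LinearMap.comp_apply]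
    induction s using Finset.strongInduction with
    | H s ih =>
      by_cases h : s = ∅
      · subst h
        rw [sd_empty]; simp [bd_sg]
      · rw [sd_sg b h, bd_cone]
        have : bd (sd b (bd (sg s))) = sd b (bd (bd (sg s))) := by
          rw [bd_sg]
          simp only [map_sum]
          exact Finset.sum_congr rfl fun a ha => ih _ (Finset.erase_ssubset ha)
        rw [this, bd_bd, map_zero, map_zero, add_zero]
  exact LinearMap.congr_fun this c

theorem sd_push (b : Finset α → α) (b' : Finset β → β) {f : α → β} (hf : Function.Injective f)
    (hb : ∀ s, b' (s.image f) = f (b s)) (c : Ch α) :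
    sd b' (push f c) = push f (sd b c) := by
  have : (sd b' ∘ₗ push f : Ch α →ₗ[ZMod 2] Ch β) = push f ∘ₗ sd b := by
    apply lin_ext
    intro s
    simp only [LinearMap.comp_apply]
    induction s using Finset.strongInduction with
    | H s ih =>
      by_cases h : s = ∅
      · subst h
        rw [push_sg_inj hf.injOn, sd_empty, push_sg_inj hf.injOn, Finset.image_empty, sd_empty]
      · have h2 : sd b' (push f (bd (sg s))) = push f (sd b (bd (sg s))) := by
          rw [bd_sg]
          simp only [map_sum]
          exact Finset.sum_congr rfl fun a ha => ih _ (Finset.erase_ssubset ha)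
        rw [sd_sg b h, push_cone, ← h2, push_bd, push_sg_inj hf.injOn,
          sd_sg b' (by simpa using h), hb]
  exact LinearMap.congr_fun this c

end chains

/-! ### Metric control of barycentric subdivision -/

abbrev E := Fin 3 → Fin 3 → ℝ

noncomputable def bary (s : Finset E) : E := (s.card : ℝ)⁻¹ • ∑ x ∈ s, x

theorem bary_mem {s : Finset E} (h : s ≠ ∅) : bary s ∈ convexHull ℝ (s : Set E) := by
  have hc : (s.card : ℝ) ≠ 0 := by simpa using h
  unfold bary
  rw [Finset.smul_sum]
  apply (convex_convexHull ℝ _).sum_mem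
  · intro i _; positivity
  · simp [hc]
  · intro i hi; exact subset_convexHull ℝ _ hi

theorem bary_dist {s : Finset E} {v : E} (hv : v ∈ s) {d : ℝ}
    (hd : ∀ x ∈ s, ∀ y ∈ s, dist x y ≤ d) :
    dist v (bary s) ≤ (1 - (s.card : ℝ)⁻¹) * d := by
  have hc : (s.card : ℝ) ≠ 0 := by
    simpa using (Finset.ne_empty_of_mem hv)
  have e : bary s - v = (s.card : ℝ)⁻¹ • ∑ x ∈ s.erase v, (x - v) := by
    have : ∑ x ∈ s.erase v, (x - v) = ∑ x ∈ s, (x - v) := by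
      rw [← Finset.add_sum_erase s _ hv]; simp
    rw [this, Finset.sum_sub_distrib, smul_sub, bary, Finset.sum_const, ← Nat.cast_smul_eq_nsmul ℝ,
      smul_smul, inv_mul_cancel₀ hc, one_smul]
  rw [dist_comm, dist_eq_norm, e, norm_smul]
  have h1 : ‖∑ x ∈ s.erase v, (x - v)‖ ≤ (s.erase v).card • d := by
    apply le_trans (norm_sum_le _ _)
    apply Finset.sum_le_card_nsmul
    intro x hx
    rw [← dist_eq_norm]
    exact hd _ (Finset.mem_of_mem_erase hx) _ hv
  rw [Finset.card_erase_of_mem hv, nsmul_eq_mul,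
    Nat.cast_sub (Finset.card_pos.2 ⟨v, hv⟩)] at h1
  have h0 : (0:ℝ) ≤ (s.card : ℝ)⁻¹ := by positivity
  rw [Real.norm_of_nonneg h0]
  calc _ ≤ (s.card : ℝ)⁻¹ * ((s.card - (1:ℕ) : ℝ) * d) := by gcongr
    _ = _ := by field_simp; simp; ring

theorem sd_small (N : ℕ) (hN : 0 < N) (d : ℝ) (hd0 : 0 ≤ d) (s : Finset E) (hs : s.card ≤ N)
    (hd : ∀ x ∈ s, ∀ y ∈ s, dist x y ≤ d) :
    sd bary (sg s) ∈ Sup (fun t : Finset E => t.card ≤ s.card ∧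
      (t : Set E) ⊆ convexHull ℝ (s : Set E) ∧
      ∀ x ∈ t, ∀ y ∈ t, dist x y ≤ (1 - (N : ℝ)⁻¹) * d) := by
  induction s using Finset.strongInduction with
  | H s ih =>
    by_cases h : s = ∅
    · subst h
      rw [sd_empty]
      exact sg_mem_Sup (by simp)
    · rw [sd_sg _ h, bd_sg, map_sum, map_sum]
      apply Submodule.sum_mem
      intro a ha
      refine map_mem_of_Sup _ ?_ (ih (s.erase a) (Finset.erase_ssubset ha)
        ((Finset.card_erase_le).trans hs)
        (fun x hx y hy => hd x (Finset.mem_of_mem_erase hx) y (Finset.mem_of_mem_erase hy)))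
      rintro t ⟨h1, h2, h3⟩
      by_cases hm : bary s ∈ t
      · rw [cone_sg_mem hm]; exact Submodule.zero_mem _
      · rw [cone_sg_notMem hm]
        have h2' : (t : Set E) ⊆ convexHull ℝ (s : Set E) :=
          h2.trans (convexHull_mono (by simpa using Finset.erase_subset a s))
        have hcp : 0 < s.card := Finset.card_pos.2 ⟨a, ha⟩
        have hNle : (1 - (s.card : ℝ)⁻¹) * d ≤ (1 - (N : ℝ)⁻¹) * d := by
          have : (N : ℝ)⁻¹ ≤ (s.card : ℝ)⁻¹ := by gcongr
          gcongr
        have hN0 : 0 ≤ (1 - (N : ℝ)⁻¹) * d := by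
          have : (N : ℝ)⁻¹ ≤ 1 := inv_le_one_of_one_le₀ (by exact_mod_cast hN)
          exact mul_nonneg (by linarith) hd0
        have hb : ∀ y ∈ t, dist y (bary s) ≤ (1 - (N : ℝ)⁻¹) * d := by
          intro y hy
          have : convexHull ℝ (s : Set E) ⊆ Metric.closedBall (bary s) ((1 - (N : ℝ)⁻¹) * d) :=
            convexHull_min (fun v hv => (bary_dist hv hd).trans hNle) (convex_closedBall _ _)
          exact this (h2' hy)
        apply sg_mem_Sup
        refine ⟨?_, ?_, ?_⟩
        · rw [Finset.card_insert_of_notMem hm]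
          rw [Finset.card_erase_of_mem ha] at h1
          omega
        · rw [Finset.coe_insert]
          exact Set.insert_subset (bary_mem h) h2'
        · intro x hx y hy
          rw [Finset.mem_insert] at hx hy
          rcases hx with rfl | hx <;> rcases hy with rfl | hy
          · simpa using hN0
          · rw [dist_comm]; exact hb y hy
          · exact hb x hx
          · exact h3 x hx y hy

/-- Iterated subdivision. -/
noncomputable def sdm (m : ℕ) : Ch E →ₗ[ZMod 2] Ch E := (sd bary : Module.End (ZMod 2) (Ch E)) ^ m

theorem sdm_succ (m : ℕ) (c : Ch E) : sdm (m + 1) c = sd bary (sdm m c) := by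
  simp [sdm, pow_succ']

theorem sdm_zero (c : Ch E) : sdm 0 c = c := by simp [sdm]

theorem sdm_empty (m : ℕ) : sdm m (sg ∅) = sg ∅ := by
  induction m with
  | zero => exact sdm_zero _
  | succ m ih => rw [sdm_succ, ih, sd_empty]

theorem sdm_bd (m : ℕ) (c : Ch E) : bd (sdm m c) = sdm m (bd c) := by
  induction m with
  | zero => simp [sdm_zero]
  | succ m ih => rw [sdm_succ, sdm_succ, sd_bd, ih]

theorem sdm_push (m : ℕ) {f : E → E} (hf : Function.Injective f)
    (hb : ∀ s, bary (s.image f) = f (bary s)) (c : Ch E) :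
    sdm m (push f c) = push f (sdm m c) := by
  induction m with
  | zero => simp [sdm_zero]
  | succ m ih => rw [sdm_succ, sdm_succ, ih, sd_push bary bary hf hb]

theorem sdm_small (N : ℕ) (hN : 0 < N) (d : ℝ) (hd0 : 0 ≤ d) (s : Finset E) (hs : s.card ≤ N)
    (hd : ∀ x ∈ s, ∀ y ∈ s, dist x y ≤ d) (m : ℕ) :
    sdm m (sg s) ∈ Sup (fun t : Finset E => t.card ≤ N ∧
      (t : Set E) ⊆ convexHull ℝ (s : Set E) ∧
      ∀ x ∈ t, ∀ y ∈ t, dist x y ≤ (1 - (N : ℝ)⁻¹) ^ m * d) := by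
  have hq : 0 ≤ 1 - (N : ℝ)⁻¹ := by
    have : (N : ℝ)⁻¹ ≤ 1 := inv_le_one_of_one_le₀ (by exact_mod_cast hN)
    linarith
  induction m with
  | zero =>
    rw [sdm_zero]
    exact sg_mem_Sup ⟨hs, subset_convexHull ℝ _, by simpa using hd⟩
  | succ m ih =>
    rw [sdm_succ]
    refine map_mem_of_Sup _ ?_ ih
    rintro t ⟨h1, h2, h3⟩
    refine Finsupp.supported_mono ?_ (sd_small N hN _ (by positivity) t h1 h3)
    rintro u ⟨g1, g2, g3⟩
    refine ⟨g1.trans h1, g2.trans (convexHull_min h2 (convex_convexHull ℝ _)), ?_⟩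
    intro x hx y hy
    rw [pow_succ', mul_assoc]
    exact g3 x hx y hy

/-! ### Trace computations -/

theorem lin_apply {Λ : Type} [Fintype Λ] [DecidableEq Λ] (f : Ch Λ →ₗ[ZMod 2] Ch Λ) (c : Ch Λ)
    (s : Finset Λ) : f c s = ∑ t : Finset Λ, c t * f (sg t) s := by
  have : (Finsupp.lapply s ∘ₗ f : Ch Λ →ₗ[ZMod 2] ZMod 2) =
      ∑ t : Finset Λ, (f (sg t) s) • Finsupp.lapply t := by
    apply lin_ext
    intro u
    simp [Finsupp.single_apply]
  have h2 := LinearMap.congr_fun this c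
  simp only [LinearMap.comp_apply, Finsupp.lapply_apply, LinearMap.sum_apply,
    LinearMap.smul_apply, smul_eq_mul] at h2
  rw [h2]
  exact Finset.sum_congr rfl fun t _ => mul_comm _ _

theorem trace_zero {Λ : Type} [Fintype Λ] [DecidableEq Λ] (h : Ch Λ →ₗ[ZMod 2] Ch Λ)
    (P : Finset Λ → Prop) (hP : ∀ s t, s ⊆ t → P t → P s) (hh : ∀ s, h (sg s) ∈ Sup P) :
    ∑ s ∈ Finset.univ.filter P, (bd (h (sg s)) + h (bd (sg s))) s = 0 := by
  have h1 : ∀ s, bd (h (sg s)) s =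
      ∑ t ∈ Finset.univ.filter P, h (sg s) t * bd (sg t) s := by
    intro s
    rw [lin_apply bd, Finset.sum_filter]
    apply Finset.sum_congr rfl
    intro t _
    split_ifs with ht
    · rfl
    · have : h (sg s) t = 0 := by
        by_contra h0
        exact ht ((Finsupp.mem_supported _ _).1 (hh s) (by simpa using h0))
      rw [this, zero_mul]
  have h2 : ∀ s, P s → h (bd (sg s)) s =
      ∑ t ∈ Finset.univ.filter P, h (sg t) s * bd (sg s) t := by
    intro s hs
    rw [lin_apply h, Finset.sum_filter]
    apply Finset.sum_congr rfl
    intro t _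
    split_ifs with ht
    · exact mul_comm _ _
    · have : bd (sg s) t = 0 := by
        rw [bd_sg, Finsupp.finsetSum_apply]
        apply Finset.sum_eq_zero
        intro a _
        rw [sg, Finsupp.single_apply, if_neg]
        rintro rfl
        exact ht (hP _ _ (Finset.erase_subset a s) hs)
      rw [this, zero_mul]
  simp only [Finsupp.add_apply]
  rw [Finset.sum_add_distrib, Finset.sum_congr rfl (fun s _ => h1 s),
    Finset.sum_congr rfl (fun s hs => h2 s (Finset.mem_filter.1 hs).2), Finset.sum_comm]
  exact CharTwo.add_self_eq_zero _

/-! ### Labels: vertices of the cross polytope -/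

abbrev Lab := (Fin 3 × Fin 3) × Bool

noncomputable def sb (e : Bool) : ℝ := if e then 1 else -1

noncomputable def vtx (l : Lab) : E := fun b i => if (b, i) = l.1 then sb l.2 else 0

noncomputable def act (g : KleinG) (l : Lab) : Lab :=
  (l.1, if χ l.1.2 g = 1 then l.2 else !l.2)

def good (s : Finset Lab) : Prop := ∀ j, ¬ ((j, true) ∈ s ∧ (j, false) ∈ s)

theorem χ_cases (i : Fin 3) (g : KleinG) : χ i g = 1 ∨ χ i g = -1 := by
  fin_cases i <;> simp only [χ] <;> split_ifs <;> simp

theorem σ_σ (g : KleinG) (x : E) : σ g (σ g x) = x := by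
  funext b i
  simp only [σ]
  rcases χ_cases i g with h | h <;> simp [h]

theorem σ_inj (g : KleinG) : Function.Injective (σ g) :=
  Function.LeftInverse.injective (σ_σ g)

theorem act_act (g : KleinG) (l : Lab) : act g (act g l) = l := by
  obtain ⟨j, e⟩ := l
  simp only [act]
  split_ifs <;> simp

theorem act_comm (g h : KleinG) (l : Lab) : act g (act h l) = act h (act g l) := by
  obtain ⟨j, e⟩ := l
  simp only [act]
  split_ifs <;> simp

theorem act_inj (g : KleinG) : Function.Injective (act g) :=
  Function.LeftInverse.injective (act_act g)

theorem vtx_act (g : KleinG) (l : Lab) : vtx (act g l) = σ g (vtx l) := by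
  obtain ⟨⟨b0, i0⟩, e⟩ := l
  funext b i
  simp only [vtx, act, σ]
  by_cases h : (b, i) = (b0, i0)
  · simp only [Prod.mk.injEq] at h
    obtain ⟨rfl, rfl⟩ := h
    rcases χ_cases i g with h | h
    · simp [h]
    · have : ¬ ((-1 : ℝ) = 1) := by norm_num
      cases e <;> simp [h, this, sb]
  · rw [if_neg h, if_neg h, mul_zero]

theorem sb_inj : Function.Injective sb := by
  intro a b h
  cases a <;> cases b <;> simp [sb] at h ⊢ <;> norm_num at h

theorem sb_ne (e : Bool) : sb e ≠ 0 := by cases e <;> simp [sb]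

theorem vtx_inj : Function.Injective vtx := by
  rintro ⟨⟨b, i⟩, e⟩ ⟨⟨b', i'⟩, e'⟩ h
  have h1 := congrFun (congrFun h b) i
  simp only [vtx, if_true] at h1
  by_cases hj : (b, i) = (b', i')
  · rw [if_pos hj] at h1
    rw [sb_inj h1, hj]
  · rw [if_neg hj] at h1
    exact absurd h1 (sb_ne e)

theorem vtx_norm (l : Lab) : ‖vtx l‖ ≤ 1 := by
  rw [pi_norm_le_iff_of_nonneg zero_le_one]
  intro b
  rw [pi_norm_le_iff_of_nonneg zero_le_one]
  intro i
  simp only [vtx]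
  split_ifs
  · cases l.2 <;> simp [sb]
  · simp

theorem bary_σ (g : KleinG) (s : Finset E) : bary (s.image (σ g)) = σ g (bary s) := by
  unfold bary
  rw [Finset.card_image_of_injective _ (σ_inj g), Finset.sum_image (fun x _ y _ h => σ_inj g h)]
  funext b i
  simp only [σ, Pi.smul_apply, Finset.sum_apply, smul_eq_mul, Finset.mul_sum]
  apply Finset.sum_congr rfl
  intro x _
  ring

noncomputable def idx (w : E) : Fin 3 × Fin 3 :=
  if h : ∃ p : Fin 3 × Fin 3, 1 / 3 ≤ w p.1 p.2 then h.choose else (0, 0)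

noncomputable def posb (r : ℝ) : Bool := decide (0 < r)

theorem posb_neg {r : ℝ} (h : r ≠ 0) : posb (-1 * r) = !posb r := by
  unfold posb
  rcases lt_or_gt_of_ne h with h' | h'
  · simp [h', h'.le]
  · simp [h', h'.le]

noncomputable def lam (y : E) : Lab :=
  (idx (fun b i => |y b i|), posb (y (idx (fun b i => |y b i|)).1 (idx (fun b i => |y b i|)).2))

theorem idx_spec {y : E} (hy : y ∈ S) :
    1 / 3 ≤ |y (idx (fun b i => |y b i|)).1 (idx (fun b i => |y b i|)).2| := by
  have h : ∃ p : Fin 3 × Fin 3, 1 / 3 ≤ |y p.1 p.2| := by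
    by_contra! hc
    have h1 : ∀ b i, (y b i) ^ 2 < 1 / 9 := by
      intro b i
      have := hc (b, i)
      rw [← sq_abs]
      have h0 := abs_nonneg (y b i)
      simp only at this
      nlinarith
    have h2 : ∑ b : Fin 3, ∑ i : Fin 3, (y b i) ^ 2 = 1 := hy
    simp only [Fin.sum_univ_three] at h2
    linarith [h1 0 0, h1 0 1, h1 0 2, h1 1 0, h1 1 1, h1 1 2, h1 2 0, h1 2 1, h1 2 2]
  have e : idx (fun b i => |y b i|) = h.choose := by
    unfold idx
    exact dif_pos h
  rw [e]
  exact h.choose_spec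

theorem lam_σ (g : KleinG) {y : E} (hy : y ∈ S) : lam (σ g y) = act g (lam y) := by
  have e : (fun b i => |σ g y b i|) = (fun b i => |y b i|) := by
    funext b i
    simp only [σ]
    rcases χ_cases i g with h | h <;> simp [h]
  have key : ∀ j : Fin 3 × Fin 3, y j.1 j.2 ≠ 0 →
      ((j, posb (σ g y j.1 j.2)) : Lab) = act g (j, posb (y j.1 j.2)) := by
    intro j hne
    simp only [act, σ]
    rcases χ_cases j.2 g with h | h
    · simp [h]
    · have : ¬ ((-1 : ℝ) = 1) := by norm_num
      simp only [h, if_neg this, posb_neg hne]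
  have h3 := idx_spec hy
  unfold lam
  rw [e]
  apply key
  intro h0
  rw [h0] at h3
  norm_num at h3

theorem lam_good {y y' : E} (hy : y ∈ S) (hy' : y' ∈ S) (j : Fin 3 × Fin 3)
    (h : lam y = (j, true)) (h' : lam y' = (j, false)) : 1 / 2 ≤ dist y y' := by
  have a := idx_spec hy
  have a' := idx_spec hy'
  simp only [lam, Prod.mk.injEq] at h h'
  rw [h.1] at a h
  rw [h'.1] at a' h'
  have p := h.2
  have p' := h'.2
  simp only [posb, decide_eq_true_eq, decide_eq_false_iff_not, not_lt] at p p'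
  rw [abs_of_pos p] at a
  rw [abs_of_nonpos p'] at a'
  have d1 := dist_le_pi_dist (y j.1) (y' j.1) j.2
  have d2 := dist_le_pi_dist y y' j.1
  rw [Real.dist_eq] at d1
  have := le_abs_self (y j.1 j.2 - y' j.1 j.2)
  linarith

theorem good_mono (s t : Finset Lab) (h : s ⊆ t) (ht : good t) : good s :=
  fun j hj => ht j ⟨h hj.1, h hj.2⟩

theorem good_act (g : KleinG) {s : Finset Lab} (h : good s) : good (s.image (act g)) := by
  intro j hj
  have key : ∀ e, (j, e) ∈ s.image (act g) → (act g (j, e)) ∈ s := by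
    intro e he
    obtain ⟨l, hl, hle⟩ := Finset.mem_image.1 he
    rw [← hle, act_act]; exact hl
  have h1 := key _ hj.1
  have h2 := key _ hj.2
  simp only [act] at h1 h2
  split_ifs at h1 h2
  · exact h j ⟨h1, h2⟩
  · exact h j ⟨h2, h1⟩

theorem not_fixed {s : Finset Lab} (h : good s) (hne : s ≠ ∅)
    (h1 : s.image (act (1, 0)) = s) : s.image (act (0, 1)) ≠ s := by
  intro h2
  obtain ⟨⟨⟨b, i⟩, e⟩, hl⟩ := Finset.nonempty_iff_ne_empty.2 hne
  have m1 : act (1, 0) ((b, i), e) ∈ s := h1 ▸ Finset.mem_image_of_mem _ hl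
  have m2 : act (0, 1) ((b, i), e) ∈ s := h2 ▸ Finset.mem_image_of_mem _ hl
  have hh : ((b, i), !e) ∈ s := by
    have : ¬ ((-1 : ℝ) = 1) := by norm_num
    fin_cases i
    · simpa [act, χ, this] using m2
    · simpa [act, χ, this] using m1
    · simpa [act, χ, this] using m1
  cases e
  · exact h (b, i) ⟨hh, hl⟩
  · exact h (b, i) ⟨hl, hh⟩

/-- The parity count coming from equivariance. -/
theorem trace_one (T : Finset Lab → ZMod 2) (h0 : T ∅ = 1)
    (hT : ∀ g s, good s → T (s.image (act g)) = T s) :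
    ∑ s ∈ Finset.univ.filter good, T s = 1 := by
  have he : ∅ ∈ Finset.univ.filter good := by simp [good]
  rw [← Finset.add_sum_erase _ _ he, h0]
  have ii : ∀ g (s : Finset Lab), (s.image (act g)).image (act g) = s := by
    intro g s
    rw [Finset.image_image]
    have : act g ∘ act g = id := funext (act_act g)
    rw [this, Finset.image_id]
  have ic : ∀ g h (s : Finset Lab), (s.image (act g)).image (act h) =
      (s.image (act h)).image (act g) := by
    intro g h s
    rw [Finset.image_image, Finset.image_image]
    congr 1
    exact funext (act_comm h g)
  have : ∑ s ∈ (Finset.univ.filter good).erase ∅, T s = 0 := by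
    apply Finset.sum_involution
      (fun s _ => if s.image (act (1, 0)) ≠ s then s.image (act (1, 0)) else s.image (act (0, 1)))
    · intro s hs
      have hg : good s := by simpa using (Finset.mem_erase.1 hs).2
      split_ifs
      · rw [hT _ _ hg]; exact CharTwo.add_self_eq_zero _
      · rw [hT _ _ hg]; exact CharTwo.add_self_eq_zero _
    · intro s hs _
      have hg : good s := by simpa using (Finset.mem_erase.1 hs).2
      have hne := (Finset.mem_erase.1 hs).1
      split_ifs with h
      · exact h
      · exact not_fixed hg hne (not_not.1 h)
    · intro s hs
      by_cases h : s.image (act (1, 0)) = s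
      · simp only [h, ne_eq, not_true_eq_false, if_false]
        rw [ic (0, 1) (1, 0), h, if_neg (by simp), ii]
      · simp only [ne_eq, h, not_false_eq_true, if_true]
        rw [ii, if_pos (Ne.symm h)]
    · intro s hs
      have hg : good s := by simpa using (Finset.mem_erase.1 hs).2
      have hne := (Finset.mem_erase.1 hs).1
      have : ∀ g, s.image (act g) ∈ (Finset.univ.filter good).erase ∅ := by
        intro g
        rw [Finset.mem_erase]
        exact ⟨by simpa using hne, by simpa using good_act g hg⟩
      split_ifs
      · exact this _
      · exact this _
  rw [this, add_zero]

/-! ### The main argument -/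

theorem main_aux (F : E → E) (hF : Continuous F) (hS : ∀ x, F x ∈ S)
    (heq : ∀ k x, 1 / 9 ≤ ∑ b : Fin 3, ∑ i : Fin 3, (x b i) ^ 2 → F (σ k x) = σ k (F x)) :
    False := by
  have huc : UniformContinuousOn F (Metric.closedBall 0 1) :=
    (isCompact_closedBall 0 1).uniformContinuousOn_of_continuous hF.continuousOn
  obtain ⟨δ, hδ, hFδ⟩ := Metric.uniformContinuousOn_iff.1 huc (1 / 2) (by norm_num)
  obtain ⟨m, hm⟩ : ∃ m : ℕ, (1 - ((19 : ℕ) : ℝ)⁻¹) ^ m * 2 < δ := by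
    obtain ⟨m, hm⟩ := exists_pow_lt_of_lt_one (half_pos hδ)
      (show (1 - ((19 : ℕ) : ℝ)⁻¹) < 1 by norm_num)
    exact ⟨m, by linarith⟩
  set Lm : E → Lab := lam ∘ F with hLm
  let h : Ch Lab →ₗ[ZMod 2] Ch Lab := push Lm ∘ₗ sdm m ∘ₗ cone 0 ∘ₗ push vtx
  let φ : Ch Lab →ₗ[ZMod 2] Ch Lab := push Lm ∘ₗ sdm m ∘ₗ push vtx
  have hφ : ∀ c, φ c = bd (h c) + h (bd c) := by
    intro c
    simp only [h, φ, LinearMap.comp_apply]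
    rw [← push_bd, sdm_bd, bd_cone, push_bd, map_add, map_add, add_assoc, ch_add_self, add_zero]
  -- the homotopy takes values in chains on the cross polytope
  have hgood : ∀ s, h (sg s) ∈ Sup good := by
    intro s
    simp only [h, LinearMap.comp_apply]
    rw [push_sg_inj vtx_inj.injOn]
    have h0 : (0 : E) ∉ s.image vtx := by
      intro h0
      obtain ⟨l, _, hl⟩ := Finset.mem_image.1 h0
      have := congrFun (congrFun hl l.1.1) l.1.2
      simp only [vtx, Prod.mk.eta, if_true, Pi.zero_apply] at this
      exact sb_ne _ this
    rw [cone_sg_notMem h0]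
    have hcard : (insert (0 : E) (s.image vtx)).card ≤ 19 := by
      have c1 := Finset.card_insert_le (0 : E) (s.image vtx)
      have c2 : (s.image vtx).card ≤ s.card := Finset.card_image_le
      have c3 : s.card ≤ Fintype.card Lab := Finset.card_le_univ s
      have c4 : Fintype.card Lab = 18 := by simp [Lab]
      omega
    have hball : ((insert (0 : E) (s.image vtx) : Finset E) : Set E) ⊆ Metric.closedBall 0 1 := by
      intro x hx
      rw [Finset.mem_coe, Finset.mem_insert] at hx
      rw [mem_closedBall_zero_iff]
      rcases hx with rfl | hx
      · simp
      · obtain ⟨l, _, rfl⟩ := Finset.mem_image.1 hx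
        exact vtx_norm l
    have hd : ∀ x ∈ insert (0 : E) (s.image vtx), ∀ y ∈ insert (0 : E) (s.image vtx),
        dist x y ≤ 2 := by
      intro x hx y hy
      have hx' := mem_closedBall_zero_iff.1 (hball hx)
      have hy' := mem_closedBall_zero_iff.1 (hball hy)
      rw [dist_eq_norm]
      linarith [norm_sub_le x y]
    refine map_mem_of_Sup _ ?_ (sdm_small 19 (by norm_num) 2 (by norm_num) _ hcard hd m)
    rintro t ⟨-, h2, h3⟩
    have h2' : (t : Set E) ⊆ Metric.closedBall 0 1 :=
      h2.trans (convexHull_min hball (convex_closedBall _ _))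
    by_cases hi : Set.InjOn Lm (t : Set E)
    · rw [push_sg_inj hi]
      apply sg_mem_Sup
      rintro j ⟨j1, j2⟩
      obtain ⟨x, hx, hxl⟩ := Finset.mem_image.1 j1
      obtain ⟨y, hy, hyl⟩ := Finset.mem_image.1 j2
      have := lam_good (hS x) (hS y) j hxl hyl
      have := hFδ x (h2' hx) y (h2' hy) ((h3 x hx y hy).trans_lt hm)
      linarith
    · rw [push_sg_ninj hi]; exact Submodule.zero_mem _
  have t0 := trace_zero h good good_mono hgood
  have t1 := trace_one (fun s => φ (sg s) s) ?_ ?_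
  · simp only [hφ] at t1
    rw [t0] at t1
    exact zero_ne_one t1
  · simp only [φ, LinearMap.comp_apply]
    rw [push_sg_inj vtx_inj.injOn, Finset.image_empty, sdm_empty, push_sg_inj (by simp),
      Finset.image_empty]
    simp [sg]
  · intro g s hs
    have e1 : φ (sg (s.image (act g))) = push (act g) (φ (sg s)) := by
      simp only [φ, LinearMap.comp_apply]
      rw [← push_sg_inj (act_inj g).injOn, push_push]
      have : vtx ∘ act g = σ g ∘ vtx := funext (vtx_act g)
      rw [this, ← push_push vtx (σ g), sdm_push m (σ_inj g) (bary_σ g), push_push, push_push,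
        push_sg_inj vtx_inj.injOn]
      have hcard : (s.image vtx).card ≤ 19 := by
        have c2 : (s.image vtx).card ≤ s.card := Finset.card_image_le
        have c3 : s.card ≤ Fintype.card Lab := Finset.card_le_univ s
        have c4 : Fintype.card Lab = 18 := by simp [Lab]
        omega
      have hd : ∀ x ∈ s.image vtx, ∀ y ∈ s.image vtx, dist x y ≤ 2 := by
        intro x hx y hy
        obtain ⟨l, _, rfl⟩ := Finset.mem_image.1 hx
        obtain ⟨l', _, rfl⟩ := Finset.mem_image.1 hy
        rw [dist_eq_norm]
        linarith [norm_sub_le (vtx l) (vtx l'), vtx_norm l, vtx_norm l']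
      refine push_congr ?_ (sdm_small 19 (by norm_num) 2 (by norm_num) _ hcard hd m)
      rintro t ⟨-, h2, -⟩ x hx
      simp only [Function.comp_apply, hLm]
      rw [heq, lam_σ g (hS x)]
      -- the point `x` lies on a face of the cross polytope
      let ε : Fin 3 → Fin 3 → ℝ := fun b i => if ((b, i), true) ∈ s then 1 else -1
      let ℓ : E →ₗ[ℝ] ℝ := ∑ b : Fin 3, ∑ i : Fin 3,
        (ε b i) • ((LinearMap.proj i : (Fin 3 → ℝ) →ₗ[ℝ] ℝ) ∘ₗ
          (LinearMap.proj b : E →ₗ[ℝ] (Fin 3 → ℝ)))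
      have hℓ : ∀ x, ℓ x = ∑ b : Fin 3, ∑ i : Fin 3, ε b i * x b i := by
        intro x
        simp [ℓ]
      have hmem : x ∈ {x : E | ℓ x = 1} := by
        refine convexHull_min ?_ (convex_hyperplane ℓ.isLinear 1) (h2 hx)
        intro y hy
        obtain ⟨⟨⟨b, i⟩, e⟩, hl, rfl⟩ := Finset.mem_image.1 hy
        show ℓ _ = 1
        rw [hℓ, Finset.sum_eq_single b, Finset.sum_eq_single i]
        · cases e
          · have : ((b, i), true) ∉ s := fun h' => hs (b, i) ⟨h', hl⟩
            simp [vtx, ε, this, sb]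
          · simp [vtx, ε, hl, sb]
        · intro i' _ hi'
          simp [vtx, hi']
        · simp
        · intro b' _ hb'
          apply Finset.sum_eq_zero
          intro i' _
          simp [vtx, hb']
        · simp
      have h1 : ∑ b : Fin 3, ∑ i : Fin 3, ε b i * x b i = 1 := by rw [← hℓ]; exact hmem
      have h4 : ∀ b i, 2 * (ε b i * x b i) / 9 ≤ ((x b i) ^ 2 + 1 / 81) * 1 * 1 := by
        intro b i
        have : ε b i = 1 ∨ ε b i = -1 := by
          simp only [ε]; split_ifs <;> simp
        rcases this with h' | h' <;> rw [h']
        · nlinarith [sq_nonneg (x b i - 1 / 9)]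
        · nlinarith [sq_nonneg (x b i + 1 / 9)]
      simp only [Fin.sum_univ_three] at h1 ⊢
      linarith [h4 0 0, h4 0 1, h4 0 2, h4 1 0, h4 1 1, h4 1 2, h4 2 0, h4 2 1, h4 2 2]
    show φ (sg (s.image (act g))) (s.image (act g)) = φ (sg s) s
    rw [e1, push_apply_image (act_inj g)]

/-! ### From the join to the ball -/

noncomputable def nrm (x : E) : ℝ := Real.sqrt (∑ b : Fin 3, ∑ i : Fin 3, (x b i) ^ 2)

theorem nrm_smul {c : ℝ} (hc : 0 ≤ c) (x : E) : nrm (c • x) = c * nrm x := by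
  unfold nrm
  have : ∑ b : Fin 3, ∑ i : Fin 3, ((c • x) b i) ^ 2 =
      c ^ 2 * ∑ b : Fin 3, ∑ i : Fin 3, (x b i) ^ 2 := by
    simp only [Pi.smul_apply, smul_eq_mul, mul_pow, Finset.mul_sum]
  rw [this, Real.sqrt_mul (sq_nonneg c), Real.sqrt_sq hc]

theorem nrm_σ (k : KleinG) (x : E) : nrm (σ k x) = nrm x := by
  unfold nrm
  congr 1
  apply Finset.sum_congr rfl
  intro b _
  apply Finset.sum_congr rfl
  intro i _
  simp only [σ]
  rcases χ_cases i k with h | h <;> simp [h]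

theorem nrm_cont : Continuous nrm := by
  unfold nrm
  fun_prop

noncomputable def rad (x : E) : E := (max (nrm x) (1 / 3))⁻¹ • x

theorem nrm_rad (x : E) : nrm (rad x) = (max (nrm x) (1 / 3))⁻¹ * nrm x := by
  unfold rad
  exact nrm_smul (by positivity) x

noncomputable def toJ (x : E) : E × (KleinG → ℝ) :=
  (rad x, fun g => if g = 0 then 1 - nrm (rad x) else 0)

theorem rad_le (x : E) : nrm (rad x) ≤ 1 := by
  rw [nrm_rad, inv_mul_le_iff₀ (by positivity), mul_one]
  exact le_max_left _ _

theorem toJ_mem (x : E) : toJ x ∈ J := by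
  refine ⟨?_, ⟨0, ?_⟩, ?_⟩
  · intro g
    simp only [toJ]
    split_ifs
    · linarith [rad_le x]
    · exact le_refl _
  · intro g hg
    simp [toJ, hg]
  · show nrm (rad x) + ∑ g : KleinG, (if g = 0 then 1 - nrm (rad x) else 0) = 1
    rw [Finset.sum_ite_eq' Finset.univ (0 : KleinG)]
    simp

theorem rad_cont : Continuous rad := by
  unfold rad
  refine Continuous.smul (f := fun x : E => (max (nrm x) (1 / 3))⁻¹) ?_ continuous_id'
  apply Continuous.inv₀ (nrm_cont.max continuous_const)
  intro x
  positivity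

theorem toJ_cont : Continuous toJ := by
  unfold toJ
  apply rad_cont.prodMk
  apply continuous_pi
  intro g
  split_ifs
  · exact continuous_const.sub (nrm_cont.comp rad_cont)
  · exact continuous_const

theorem toJ_σ (k : KleinG) (x : E) (hx : 1 / 3 ≤ nrm x) : toJ (σ k x) = τ k (toJ x) := by
  have r1 : rad (σ k x) = σ k (rad x) := by
    unfold rad
    rw [nrm_σ]
    funext b i
    simp only [σ, Pi.smul_apply, smul_eq_mul]
    ring
  have r2 : nrm (rad x) = 1 := by
    rw [nrm_rad, max_eq_left hx, inv_mul_cancel₀ (by linarith)]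
  have r3 : nrm (rad (σ k x)) = 1 := by rw [r1, nrm_σ, r2]
  unfold toJ τ
  refine Prod.ext r1 ?_
  funext g
  simp [r2, r3]

/-- **Theorem 2.3** (`thm:seven-BU`, key Borsuk–Ulam type statement): there is no
Klein-four-group equivariant continuous map from the join `S * [4]` (of the `8`-sphere
`S = (S²)^{*3}` with a transitive `4`-point `G`-set) to `S`. -/
theorem no_equivariant_map_join_to_sphere :
    ¬ ∃ f : J → S, Continuous f ∧
      ∀ (k : KleinG) (p : J) (hkp : τ k (p : (Fin 3 → Fin 3 → ℝ) × (KleinG → ℝ)) ∈ J),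
        (f ⟨τ k (p : (Fin 3 → Fin 3 → ℝ) × (KleinG → ℝ)), hkp⟩ : Fin 3 → Fin 3 → ℝ) =
          σ k (f p : Fin 3 → Fin 3 → ℝ) := by
  rintro ⟨f, hf, hfe⟩
  refine main_aux (fun x => (f ⟨toJ x, toJ_mem x⟩ : Fin 3 → Fin 3 → ℝ)) ?_ ?_ ?_
  · exact continuous_subtype_val.comp (hf.comp (toJ_cont.subtype_mk _))
  · intro x
    exact (f ⟨toJ x, toJ_mem x⟩).2
  · intro k x hx
    have hn : 1 / 3 ≤ nrm x := by
      apply Real.le_sqrt_of_sq_le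
      norm_num at hx ⊢
      exact hx
    have e := toJ_σ k x hn
    have hk : τ k (toJ x) ∈ J := e ▸ toJ_mem (σ k x)
    rw [← hfe k ⟨toJ x, toJ_mem x⟩ hk]
    simp only [e]

end JoinBU
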